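/- Let X be a set and let (k_j)_{j∈ℕ} be a sequence of positive definite kernels k_j : X × X → ℂ. Fix N ∈ ℕ and assume that for all x, y ∈ X the families (1 + k_j(x,y))_{j∈ℕ} and (1 + k_j(x,y))_{j>N} are multipliable. Define K(x,y) := ∏_{j=1}^∞ (1 + k_j(x,y)) and K_N(x,y) := ∏_{j=1}^N (1 + k_j(x,y)). Then K − K_N is a positive definite kernel on X; in particular K_N(x,x) ≤ K(x,x) for all x ∈ X. -/

import Mathlib

open scoped ComplexOrder

/-- A kernel `K : X × X → ℂ` is positive definite. -/
def PosDefKernel {X : Type*} (K : X → X → ℂ) : Prop :=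
  ∀ (n : ℕ) (x : Fin n → X) (c : Fin n → ℂ),
    0 ≤ ∑ i, ∑ j, c i * (starRingEnd ℂ) (c j) * K (x i) (x j)

open Filter Topology

theorem Matrix.posSemidef_of_forall_dotProduct_mulVec_nonneg {n : Type*} [Fintype n]
    {M : Matrix n n ℂ} (h : ∀ v : n → ℂ, 0 ≤ star v ⬝ᵥ M.mulVec v) : M.PosSemidef := by
  classical
  rw [← Matrix.isPositive_toEuclideanLin_iff, LinearMap.isPositive_iff_complex]
  intro v
  have hv : 0 ≤ inner ℂ (M.toEuclideanLin v) v := by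
    have hre : inner ℂ v (M.toEuclideanLin v) = star v.ofLp ⬝ᵥ M.mulVec v.ofLp := by
      rw [EuclideanSpace.inner_eq_star_dotProduct, Matrix.ofLp_toLpLin, Matrix.toLin'_apply,
        dotProduct_comm]
    rw [← inner_conj_symm, hre]
    exact star_nonneg_iff.mpr (h v.ofLp)
  obtain ⟨hnonneg, him⟩ := Complex.nonneg_iff.mp hv
  exact ⟨Complex.ext rfl him, hnonneg⟩

namespace PosDefKernel

variable {X : Type*} {K L : X → X → ℂ}

theorem iff_posSemidef : PosDefKernel K ↔
    ∀ (n : ℕ) (x : Fin n → X), (Matrix.of fun i j => K (x i) (x j)).PosSemidef := by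
  have hform (n : ℕ) (x : Fin n → X) (v : Fin n → ℂ) :
      star v ⬝ᵥ (Matrix.of fun i j => K (x i) (x j)).mulVec v =
        ∑ i, ∑ j, star v i * (starRingEnd ℂ) (star v j) * K (x i) (x j) := by
    simp only [dotProduct, Matrix.mulVec, Matrix.of_apply, Finset.mul_sum, Pi.star_apply,
      starRingEnd_apply, star_star]
    exact Finset.sum_congr rfl fun i _ => Finset.sum_congr rfl fun j _ => by ring
  refine ⟨fun h n x => Matrix.posSemidef_of_forall_dotProduct_mulVec_nonneg fun v => ?_,
    fun h n x c => ?_⟩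
  · rw [hform]
    exact h n x (star v)
  · have := (h n x).dotProduct_mulVec_nonneg (star c)
    rwa [hform, star_star] at this

theorem zero : PosDefKernel fun _ _ : X => (0 : ℂ) := fun n x c => by simp

theorem one : PosDefKernel fun _ _ : X => (1 : ℂ) := fun n x c => by
  simpa [← Finset.mul_sum, ← Finset.sum_mul, map_sum] using mul_star_self_nonneg (∑ i, c i)

theorem add (hK : PosDefKernel K) (hL : PosDefKernel L) :
    PosDefKernel fun x y => K x y + L x y := fun n x c => by
  simpa only [mul_add, Finset.sum_add_distrib] using add_nonneg (hK n x c) (hL n x c)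

theorem mul (hK : PosDefKernel K) (hL : PosDefKernel L) :
    PosDefKernel fun x y => K x y * L x y :=
  iff_posSemidef.mpr fun n x => (iff_posSemidef.mp hK n x).hadamard (iff_posSemidef.mp hL n x)

theorem prod {ι : Type*} {k : ι → X → X → ℂ} {s : Finset ι} (hk : ∀ i ∈ s, PosDefKernel (k i)) :
    PosDefKernel fun x y => ∏ i ∈ s, k i x y := by
  classical
  induction s using Finset.induction_on with
  | empty => simpa using one
  | insert i s hi ih =>
    simp only [Finset.prod_insert hi]
    exact (hk i (Finset.mem_insert_self i s)).mul
      (ih fun j hj => hk j (Finset.mem_insert_of_mem hj))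

theorem of_tendsto {ι : Type*} {l : Filter ι} [l.NeBot] {F : ι → X → X → ℂ}
    (hF : ∀ᶠ i in l, PosDefKernel (F i))
    (hlim : ∀ x y, Tendsto (fun i => F i x y) l (𝓝 (K x y))) : PosDefKernel K := fun n x c =>
  ge_of_tendsto
    (tendsto_finsetSum _ fun i _ => tendsto_finsetSum _ fun j _ => (hlim (x i) (x j)).const_mul _)
    (hF.mono fun _ h => h n x c)

theorem diag_nonneg (hK : PosDefKernel K) (x : X) : 0 ≤ K x x := by
  simpa using hK 1 (fun _ => x) (fun _ => 1)

theorem prod_range_one_add_sub {k : ℕ → X → X → ℂ} (hk : ∀ j, PosDefKernel (k j)) {N m : ℕ}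
    (hm : N ≤ m) : PosDefKernel fun x y =>
      ∏ j ∈ Finset.range m, (1 + k j x y) - ∏ j ∈ Finset.range N, (1 + k j x y) := by
  induction m, hm using Nat.le_induction with
  | base => simpa using zero
  | succ m _ ih =>
    have hstep := ih.add ((prod (s := Finset.range m) fun j _ => one.add (hk j)).mul (hk m))
    convert hstep using 3
    rw [Finset.prod_range_succ]
    ring

end PosDefKernel

/-- If `(kⱼ)` are positive definite kernels on a set `X` such that the families
`(1 + kⱼ(x,y))ⱼ` and their tails past `N` are multipliable, then the difference
`K − K_N` of the full product kernel `K(x,y) = ∏ⱼ (1 + kⱼ(x,y))` and the truncated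
product `K_N(x,y) = ∏_{j<N} (1 + kⱼ(x,y))` is positive definite; in particular
`K_N(x,x) ≤ K(x,x)` for all `x`. -/
theorem product_kernel_truncation_posDef {X : Type*} (k : ℕ → X → X → ℂ)
    (hpd : ∀ j, PosDefKernel (k j)) (N : ℕ)
    (hmul : ∀ x y : X, Multipliable (fun j : ℕ => 1 + k j x y))
    (hmultail : ∀ x y : X, Multipliable (fun j : ℕ => 1 + k (N + j) x y)) :
    PosDefKernel (fun x y =>
      (∏' j : ℕ, (1 + k j x y)) - ∏ j ∈ Finset.range N, (1 + k j x y)) ∧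
    ∀ x : X, (∏ j ∈ Finset.range N, (1 + k j x x)) ≤ ∏' j : ℕ, (1 + k j x x) := by
  have hdiff : PosDefKernel fun x y =>
      (∏' j : ℕ, (1 + k j x y)) - ∏ j ∈ Finset.range N, (1 + k j x y) :=
    PosDefKernel.of_tendsto
      ((eventually_ge_atTop N).mono fun _ hm => PosDefKernel.prod_range_one_add_sub hpd hm)
      fun x y => (hmul x y).hasProd.tendsto_prod_nat.sub_const _
  exact ⟨hdiff, fun x => sub_nonneg.mp (hdiff.diag_nonneg x)⟩
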